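/- arXiv:1506.04173 — 6 statements merged into one kernel-verified Lean document; each statement's English description precedes it below -/
import Mathlib

section
/- Any 3×3 Boggle logic puzzle using only three-letter words on a board with nine distinct letters must contain at least 6 different words. Precisely: if B : Fin 3 × Fin 3 → Fin 9 is a bijection and P is a finite set of three-letter words of B such that every bijection B' : Fin 3 × Fin 3 → Fin 9 whose word set contains P is equivalent to B, then the cardinality of P is at least 6. -/
/-- King-move adjacency on the cells of a 3×3 grid: two cells are adjacent if they are
distinct and their coordinates differ by at most 1 in each component. -/
def cellAdj (a b : Fin 3 × Fin 3) : Prop :=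
  a ≠ b ∧ |(a.1.val : ℤ) - (b.1.val : ℤ)| ≤ 1 ∧ |(a.2.val : ℤ) - (b.2.val : ℤ)| ≤ 1

/-- `w` is a word of the board `B`: a list of letters of length at least 2 of the form
`B c₁, …, B c_k` where the cells `c₁, …, c_k` are pairwise distinct and consecutive
cells are adjacent.  (For a bijective board this says exactly that `w` is a list of
pairwise distinct letters whose consecutive letters occupy adjacent cells.) -/
def IsWordOf {A : Type*} (B : Fin 3 × Fin 3 → A) (w : List A) : Prop :=
  2 ≤ w.length ∧
    ∃ cs : List (Fin 3 × Fin 3), cs.map B = w ∧ cs.Nodup ∧ cs.Chain' cellAdj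

/-- The set `W(B)` of all words of the board `B`. -/
def Words {A : Type*} (B : Fin 3 × Fin 3 → A) : Set (List A) :=
  {w | IsWordOf B w}

/-- The set `W_k(B)` of all `k`-letter words of the board `B`. -/
def WordsOfLen {A : Type*} (B : Fin 3 × Fin 3 → A) (k : ℕ) : Set (List A) :=
  {w | w.length = k ∧ IsWordOf B w}

/-- Rotation of the 3×3 grid by 90 degrees. -/
def rotCell (c : Fin 3 × Fin 3) : Fin 3 × Fin 3 := (c.2, 2 - c.1)

/-- Reflection of the 3×3 grid along the main diagonal. -/
def reflCell (c : Fin 3 × Fin 3) : Fin 3 × Fin 3 := (c.2, c.1)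

/-- The symmetry group of the square acting on the 3×3 grid: the eight
rotations and reflections. -/
def squareSymm : Set ((Fin 3 × Fin 3) → (Fin 3 × Fin 3)) :=
  {id, rotCell, rotCell ∘ rotCell, rotCell ∘ rotCell ∘ rotCell,
   reflCell, reflCell ∘ rotCell, reflCell ∘ rotCell ∘ rotCell,
   reflCell ∘ rotCell ∘ rotCell ∘ rotCell}

/-- Two boards are equivalent if one is obtained from the other by a symmetry
of the square. -/
def BoardEquiv {A : Type*} (B B' : Fin 3 × Fin 3 → A) : Prop :=
  ∃ σ ∈ squareSymm, B' = B ∘ σ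

instance : DecidableRel cellAdj := fun _ _ => by unfold cellAdj; infer_instance

theorem cellAdj_rotCell : ∀ a b, cellAdj (rotCell a) (rotCell b) ↔ cellAdj a b := by
  decide

theorem cellAdj_reflCell : ∀ a b, cellAdj (reflCell a) (reflCell b) ↔ cellAdj a b := by
  decide

theorem cellAdj_iff_of_mem_squareSymm {σ : Fin 3 × Fin 3 → Fin 3 × Fin 3} (hσ : σ ∈ squareSymm)
    (a b : Fin 3 × Fin 3) : cellAdj (σ a) (σ b) ↔ cellAdj a b := by
  rcases hσ with rfl | rfl | rfl | rfl | rfl | rfl | rfl | rfl <;>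
    simp [cellAdj_rotCell, cellAdj_reflCell]

/-- Decides whether at most `k` elements suffice to meet every list in a family. -/
def hasTransversal {α : Type*} [DecidableEq α] : ℕ → List (List α) → Bool
  | _, [] => true
  | 0, _ :: _ => false
  | k + 1, S :: F => S.any fun e => hasTransversal k (F.filter fun T => !T.contains e)

theorem hasTransversal_of_card_le {α : Type*} [DecidableEq α] (k : ℕ) (F : List (List α))
    (H : Finset α) (hcard : H.card ≤ k) (hmeet : ∀ S ∈ F, ∃ e ∈ S, e ∈ H) :
    hasTransversal k F = true := by
  induction k generalizing F H with
  | zero =>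
    cases F with
    | nil => rfl
    | cons S F =>
      obtain ⟨e, -, he⟩ := hmeet S List.mem_cons_self
      simp_all
  | succ k ih =>
    cases F with
    | nil => rfl
    | cons S F =>
      obtain ⟨e, heS, heH⟩ := hmeet S List.mem_cons_self
      refine List.any_eq_true.mpr ⟨e, heS, ih _ (H.erase e) ?_ fun T hT => ?_⟩
      · rw [Finset.card_erase_of_mem heH]
        lia
      · obtain ⟨hTF, heT⟩ := List.mem_filter.mp hT
        obtain ⟨f, hfT, hfH⟩ := hmeet T (List.mem_cons_of_mem _ hTF)
        refine ⟨f, hfT, Finset.mem_erase.mpr ⟨?_, hfH⟩⟩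
        rintro rfl
        simp_all

/-- A symmetric encoding of pairs of cells by natural numbers. -/
def edgeCode (a b : Fin 3 × Fin 3) : ℕ :=
  2 ^ (3 * a.1.val + a.2.val) + 2 ^ (3 * b.1.val + b.2.val)

/-- The cells of the grid, row by row. -/
def cells : List (Fin 3 × Fin 3) := List.finRange 3 ×ˢ List.finRange 3

/-- The codes of the adjacent pairs of cells that `π` sends to non-adjacent pairs. -/
def brokenEdges (π : Equiv.Perm (Fin 3 × Fin 3)) : List ℕ :=
  (((cells ×ˢ cells).filter fun p => cellAdj p.1 p.2 ∧ ¬ cellAdj (π p.1) (π p.2)).map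
    fun p => edgeCode p.1 p.2).dedup

theorem mem_brokenEdges {π : Equiv.Perm (Fin 3 × Fin 3)} {e : ℕ} :
    e ∈ brokenEdges π ↔ ∃ a b, cellAdj a b ∧ ¬ cellAdj (π a) (π b) ∧ edgeCode a b = e := by
  have hcells : ∀ c, c ∈ cells := by decide
  simp [brokenEdges, hcells, and_assoc]

/-- `rotCell` as a permutation of the cells. -/
def rotPerm : Equiv.Perm (Fin 3 × Fin 3) where
  toFun := rotCell
  invFun := rotCell ∘ rotCell ∘ rotCell
  left_inv := by decide
  right_inv := by decide

/-- `reflCell` as a permutation of the cells. -/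
def reflPerm : Equiv.Perm (Fin 3 × Fin 3) where
  toFun := reflCell
  invFun := reflCell
  left_inv := by decide
  right_inv := by decide

/-- The symmetries of the square as permutations of the cells. -/
def squarePerms : List (Equiv.Perm (Fin 3 × Fin 3)) :=
  [1, rotPerm, rotPerm * rotPerm, rotPerm * rotPerm * rotPerm,
   reflPerm, reflPerm * rotPerm, reflPerm * rotPerm * rotPerm,
   reflPerm * rotPerm * rotPerm * rotPerm]

open Equiv in
/-- Permutations of the cells that break few adjacencies, up to symmetries of the square. -/
def basicPerms : List (Perm (Fin 3 × Fin 3)) :=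
  [swap (2, 1) (2, 2),
   swap (2, 0) (2, 2),
   swap (1, 1) (1, 2),
   swap (2, 0) (2, 1) * swap (2, 1) (2, 2),
   swap (1, 1) (1, 2) * swap (2, 0) (2, 1),
   swap (1, 1) (1, 2) * swap (2, 0) (2, 2),
   swap (0, 2) (1, 0) * swap (1, 2) (2, 1),
   swap (0, 2) (1, 1) * swap (1, 1) (2, 0) * swap (2, 0) (2, 1) * swap (2, 1) (2, 2) *
     swap (2, 2) (1, 2)]

/-- The permutations obtained by first applying a symmetry of the square and then one of
`basicPerms`. -/
def testPerms : List (Equiv.Perm (Fin 3 × Fin 3)) :=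
  basicPerms.flatMap fun π => squarePerms.map fun d => π * d

theorem brokenEdges_ne_nil : ∀ π ∈ testPerms, brokenEdges π ≠ [] := by
  have h : (testPerms.all fun π => !(brokenEdges π).isEmpty) = true := by decide +kernel
  simpa using h

theorem symm_notMem_squareSymm {π : Equiv.Perm (Fin 3 × Fin 3)} (hπ : π ∈ testPerms) :
    (π.symm : _ → _) ∉ squareSymm := by
  intro hσ
  obtain ⟨_, he⟩ := List.exists_mem_of_ne_nil _ (brokenEdges_ne_nil π hπ)
  obtain ⟨a, b, hab, hbroken, -⟩ := mem_brokenEdges.mp he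
  refine hbroken ((cellAdj_iff_of_mem_squareSymm hσ _ _).mp ?_)
  simpa using hab

theorem hasTransversal_brokenEdges_eq_false :
    hasTransversal 10 (testPerms.map brokenEdges) = false := by
  decide +kernel

/-- The codes of the two steps of a three-cell path. -/
def pathEdges : List (Fin 3 × Fin 3) → Finset ℕ
  | [a, b, c] => {edgeCode a b, edgeCode b c}
  | _ => ∅

theorem card_pathEdges_le (cs : List (Fin 3 × Fin 3)) : (pathEdges cs).card ≤ 2 := by
  unfold pathEdges
  split
  · exact Finset.card_le_two
  · simp

/-- A three-letter word survives a rearrangement of the board that breaks none of its steps. -/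
theorem IsWordOf.comp_symm {A : Type*} {B : Fin 3 × Fin 3 → A} {w : List A}
    (hlen : w.length = 3) (hw : IsWordOf B w) (π : Equiv.Perm (Fin 3 × Fin 3))
    (hπ : ∀ cs : List (Fin 3 × Fin 3), cs.map B = w → ∀ e ∈ brokenEdges π, e ∉ pathEdges cs) :
    IsWordOf (B ∘ π.symm) w := by
  obtain ⟨hlen', cs, rfl, hnodup, hchain⟩ := hw
  refine ⟨hlen', cs.map π, by simp [Function.comp_assoc], hnodup.map π.injective, ?_⟩
  have hcs := hπ cs rfl
  rw [List.length_map] at hlen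
  obtain ⟨a, b, c, rfl⟩ := List.length_eq_three.mp hlen
  simp only [List.Chain', List.isChain_cons_cons, List.isChain_singleton, and_true, List.map_cons,
    List.map_nil] at hchain ⊢
  constructor <;> by_contra h
  · exact hcs _ (mem_brokenEdges.mpr ⟨a, b, hchain.1, h, rfl⟩) (by simp [pathEdges])
  · exact hcs _ (mem_brokenEdges.mpr ⟨b, c, hchain.2, h, rfl⟩) (by simp [pathEdges])

/-- Any 3×3 Boggle logic puzzle with nine distinct letters using only three-letter
words must contain at least 6 different words. -/
theorem min_six_words (B : Fin 3 × Fin 3 → Fin 9) (hB : Function.Bijective B)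
    (P : Finset (List (Fin 9)))
    (hP : ∀ w ∈ P, w.length = 3 ∧ IsWordOf B w)
    (huniq : ∀ B' : Fin 3 × Fin 3 → Fin 9, Function.Bijective B' →
      (∀ w ∈ P, IsWordOf B' w) → BoardEquiv B B') :
    6 ≤ P.card := by
  by_contra! hlt
  let e := Equiv.ofBijective B hB
  let H : Finset ℕ := P.biUnion fun w => pathEdges (w.map e.symm)
  have hcard : H.card ≤ 10 :=
    (Finset.card_biUnion_le_card_mul _ _ 2 fun _ _ => card_pathEdges_le _).trans (by lia)
  suffices hmeet : ∀ S ∈ testPerms.map brokenEdges, ∃ x ∈ S, x ∈ H by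
    simpa [hasTransversal_brokenEdges_eq_false] using hasTransversal_of_card_le 10 _ H hcard hmeet
  intro S hS
  obtain ⟨π, hπ, rfl⟩ := List.mem_map.mp hS
  by_contra! hmiss
  obtain ⟨σ, hσ, heq⟩ := huniq (B ∘ π.symm) (hB.comp π.symm.bijective) fun w hw => by
    refine (hP w hw).2.comp_symm (hP w hw).1 π ?_
    rintro cs rfl x hx hxcs
    refine hmiss x hx (Finset.mem_biUnion.mpr ⟨_, hw, ?_⟩)
    have hinv : e.symm ∘ B = id := funext e.symm_apply_apply
    simpa [hinv] using hxcs
  exact symm_notMem_squareSymm hπ (hB.injective.comp_left heq ▸ hσ)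
end

section
/- For a 3×3 Boggle board with nine distinct letters, 137 three-letter words guarantee a unique solution. Precisely: if B : Fin 3 × Fin 3 → Fin 9 is a bijection and P ⊆ W₃(B) is a set of three-letter words of B with cardinality at least 137, then every bijection B' : Fin 3 × Fin 3 → Fin 9 with P ⊆ W₃(B') is equivalent to B. -/
/-! The boards sharing at least 137 three-letter words with a given board are found by an
exhaustive search in the kernel. Up to the letters, a second board is a permutation `π` of the
cells. If it breaks at most 11 of the 80 undirected three-cell paths of the grid, then the broken
edges, each weighted with the number of paths through it, have total weight at most 22. The search
assigns the images of the cells one at a time and abandons a branch as soon as this weight is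
exceeded; the few complete assignments that remain are symmetries or break at least 12 paths. -/

namespace BoardSearch

/-- The cells of the grid, in the order in which the search assigns them. -/
def cellOrder : List (Fin 3 × Fin 3) :=
  [(1, 1), (0, 1), (1, 0), (0, 0), (1, 2), (2, 1), (0, 2), (2, 0), (2, 2)]

/-- The cell with a given position in `cellOrder`. -/
def cellAt (n : ℕ) : Fin 3 × Fin 3 := cellOrder.getD n (0, 0)

/-- The position of a cell in `cellOrder`. -/
def code (c : Fin 3 × Fin 3) : ℕ := (![![3, 1, 6], ![2, 0, 4], ![7, 5, 8]] : _ → _ → ℕ) c.1 c.2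

/-- `far x y` is `0` if the cells with codes `x` and `y` are adjacent and `1` otherwise, read off
from a bit table. -/
def far (x y : ℕ) : ℕ :=
  Nat.land 1 (Nat.shiftRight 157212914705164899734407759275800374935553
    (Nat.add (Nat.mul 16 x) y))

/-- `missed x y z` is `0` if `x, y, z` are the codes of consecutive cells of a path (possibly with
`x = z`) and `1` otherwise. -/
def missed (x y z : ℕ) : ℕ := Nat.lor (far x y) (far y z)

/-- The paths with three cells, up to reversal, as lists of codes. -/
def paths : List (ℕ × ℕ × ℕ) :=
  [(0, 1, 2), (0, 1, 3), (0, 1, 4), (0, 1, 6), (0, 2, 1), (0, 2, 3), (0, 2, 5), (0, 2, 7), (0, 3, 1),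
   (0, 3, 2), (0, 4, 1), (0, 4, 5), (0, 4, 6), (0, 4, 8), (0, 5, 2), (0, 5, 4), (0, 5, 7), (0, 5, 8),
   (0, 6, 1), (0, 6, 4), (0, 7, 2), (0, 7, 5), (0, 8, 4), (0, 8, 5), (1, 0, 2), (1, 0, 3), (1, 0, 4),
   (1, 0, 5), (1, 0, 6), (1, 0, 7), (1, 0, 8), (1, 2, 3), (1, 2, 5), (1, 2, 7), (1, 3, 2), (1, 4, 5),
   (1, 4, 6), (1, 4, 8), (1, 6, 4), (2, 0, 3), (2, 0, 4), (2, 0, 5), (2, 0, 6), (2, 0, 7), (2, 0, 8),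
   (2, 1, 3), (2, 1, 4), (2, 1, 6), (2, 5, 4), (2, 5, 7), (2, 5, 8), (2, 7, 5), (3, 0, 4), (3, 0, 5),
   (3, 0, 6), (3, 0, 7), (3, 0, 8), (3, 1, 4), (3, 1, 6), (3, 2, 5), (3, 2, 7), (4, 0, 5), (4, 0, 6),
   (4, 0, 7), (4, 0, 8), (4, 1, 6), (4, 5, 7), (4, 5, 8), (4, 8, 5), (5, 0, 6), (5, 0, 7), (5, 0, 8),
   (5, 2, 7), (5, 4, 6), (5, 4, 8), (6, 0, 7), (6, 0, 8), (6, 4, 8), (7, 0, 8), (7, 5, 8)]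

/-- The edges of the grid. The entry `(i, w)` of the `n`-th list is an edge between the cells with
codes `n - i` and `n` which lies on `w` elements of `paths`. -/
def edgeLevels : List (List (ℕ × ℕ)) :=
  [[],
   [(1, 11)],
   [(2, 11), (1, 8)],
   [(3, 9), (2, 6), (1, 6)],
   [(4, 11), (3, 8)],
   [(5, 11), (3, 8), (1, 8)],
   [(6, 9), (5, 6), (2, 6)],
   [(7, 9), (5, 6), (2, 6)],
   [(8, 9), (4, 6), (3, 6)]]

/-- The list `edgeLevels` as a list of entries `((m, n), w)`, with `m` and `n` the codes of the
endpoints and `w` the weight. -/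
def edges : List ((ℕ × ℕ) × ℕ) :=
  edgeLevels.zipIdx.flatMap fun p => p.1.map fun e => ((p.2 - e.1, p.2), e.2)

/-- The symmetries of the square. -/
def symmetries : List (Fin 3 × Fin 3 → Fin 3 × Fin 3) :=
  [id, rotCell, rotCell ∘ rotCell, rotCell ∘ rotCell ∘ rotCell, reflCell, reflCell ∘ rotCell,
   reflCell ∘ rotCell ∘ rotCell, reflCell ∘ rotCell ∘ rotCell ∘ rotCell]

/-- The assignments which come from symmetries of the square. -/
def symmetricAssignments : List (List ℕ) :=
  symmetries.map fun σ => cellOrder.map (code ∘ σ)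

/-! The following definitions use recursors directly because they are evaluated by the kernel. -/

/-- The entry of a list at a given position, or `9` if there is none. -/
def look (l : List ℕ) : ℕ → ℕ :=
  List.rec (fun _ => 9) (fun a _ ih n => Nat.rec a (fun n _ => ih n) n) l

/-- The number of paths broken by a complete assignment. -/
def brokenCount (r : List ℕ) : ℕ :=
  (paths.map fun w => missed (look r w.1) (look r w.2.1) (look r w.2.2)).sum

/-- Whether a complete assignment comes from a symmetry or breaks at least 12 paths. -/
def accept (r : List ℕ) : Bool :=
  Nat.ble 12 (brokenCount r) || decide (r ∈ symmetricAssignments)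

/-- Subtracts from `b` the weights of the edges in `es` broken by giving the value `v` to the newest
cell. The result is passed to `k` if it is positive throughout. -/
def charge (v : ℕ) (l : List ℕ) (k : ℕ → Bool) (es : List (ℕ × ℕ)) : ℕ → Bool :=
  List.rec k (fun e _ ih b => Nat.rec (ih b)
    (fun _ _ => cond (Nat.ble b e.2) true (ih (Nat.sub b e.2))) (far (look l e.1) v)) es

/-- Whether `k` holds for all ways to remove an element from `rem`; the elements of `pre` are added
to what is left. -/
def pick (k : ℕ → List ℕ → Bool) (rem : List ℕ) : List ℕ → Bool :=
  List.rec (fun _ => true)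
    (fun v rest ih pre => cond (k v (pre.reverseAux rest)) (ih (v :: pre)) false) rem

/-- Whether all extensions of the assignment `l` (newest cell first) by the values in `rem` which
break edges in `W` of total weight less than `b` are accepted. -/
def search (W : List (List (ℕ × ℕ))) : List ℕ → List ℕ → ℕ → Bool :=
  List.rec (fun l _ _ => accept l.reverse)
    (fun es _ ih l rem b =>
      pick (fun v rem' => charge v (v :: l) (ih (v :: l) rem') es b) rem []) W

theorem search_edgeLevels : search edgeLevels [] [0, 1, 2, 3, 4, 5, 6, 7, 8] 23 = true := by
  decide +kernel

/-- The weight of the edges in `es` broken by giving the value `v` to the newest cell. -/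
def lostWeight (v : ℕ) (l : List ℕ) (es : List (ℕ × ℕ)) : ℕ :=
  (es.map fun e => e.2 * far (look l e.1) v).sum

/-- The weight of the edges in `W` broken by extending the assignment `l` by the entries of `r`. -/
def totalLost : List (List (ℕ × ℕ)) → List ℕ → List ℕ → ℕ
  | es :: W, v :: r, l => lostWeight v (v :: l) es + totalLost W r (v :: l)
  | _, _, _ => 0

theorem far_le_one (x y : ℕ) : far x y ≤ 1 := Nat.and_le_left

theorem missed_le_one (x y z : ℕ) : missed x y z ≤ 1 := by
  have h (x y : ℕ) : far x y < 2 ^ 1 := Nat.lt_succ_of_le (far_le_one x y)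
  exact Nat.le_of_lt_succ (Nat.or_lt_two_pow (h x y) (h y z))

theorem far_add_far_le (x y z : ℕ) : far x y + far y z ≤ 2 * missed x y z := by
  have h₁ : far x y ≤ missed x y z := Nat.left_le_or
  have h₂ : far y z ≤ missed x y z := Nat.right_le_or
  omega

theorem of_charge (v : ℕ) (l : List ℕ) (k : ℕ → Bool) (es : List (ℕ × ℕ)) (b : ℕ)
    (h : charge v l k es b = true) (hb : lostWeight v l es < b) :
    k (b - lostWeight v l es) = true := by
  induction es generalizing b with
  | nil => exact h
  | cons e es ih =>
    have hcons : lostWeight v l (e :: es) = e.2 * far (look l e.1) v + lostWeight v l es := by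
      simp [lostWeight]
    have hstep : Nat.rec (charge v l k es b)
      (fun _ _ => cond (Nat.ble b e.2) true (charge v l k es (b - e.2)))
      (far (look l e.1) v) = true := h
    have hfar := far_le_one (look l e.1) v
    rw [hcons] at hb ⊢
    generalize far (look l e.1) v = d at *
    interval_cases d
    · simpa using ih b hstep (by omega)
    · have hble : Nat.ble b e.2 = false := by
        rw [← Bool.not_eq_true, Nat.ble_eq]
        omega
      have hrest : charge v l k es (b - e.2) = true := by simpa [hble] using hstep
      rw [mul_one, Nat.sub_add_eq]
      exact ih _ hrest (by omega)

theorem exists_of_pick (k : ℕ → List ℕ → Bool) (rem pre : List ℕ) (h : pick k rem pre = true)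
    {v : ℕ} (hv : v ∈ rem) : ∃ rem', k v rem' = true ∧ (pre ++ rem).Perm (v :: rem') := by
  induction rem generalizing pre with
  | nil => simp at hv
  | cons a rest ih =>
    have hstep : cond (k a (pre.reverseAux rest)) (pick k rest (a :: pre)) false = true := h
    rw [Bool.cond_false_right, Bool.and_eq_true] at hstep
    obtain rfl | hv := List.mem_cons.mp hv
    · refine ⟨_, hstep.1, List.perm_middle.trans (List.Perm.cons _ ?_)⟩
      rw [List.reverseAux_eq]
      exact (List.reverse_perm pre).symm.append_right rest
    · obtain ⟨rem', hk, hperm⟩ := ih _ hstep.2 hv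
      exact ⟨rem', hk, List.perm_middle.trans hperm⟩

theorem accept_of_search (W : List (List (ℕ × ℕ))) (r l rem : List ℕ) (b : ℕ)
    (hs : search W l rem b = true) (hlen : r.length = W.length) (hr : r.Perm rem)
    (hlost : totalLost W r l < b) : accept (l.reverse ++ r) = true := by
  induction W generalizing r l rem b with
  | nil =>
    obtain rfl : r = [] := by simpa using hlen
    simpa [search] using hs
  | cons es W ih =>
    obtain _ | ⟨v, r⟩ := r
    · simp at hlen
    have hp : pick (fun v rem' => charge v (v :: l) (search W (v :: l) rem') es b) rem [] = true :=
      hs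
    obtain ⟨rem', hk, hperm⟩ := exists_of_pick _ _ _ hp (hr.subset List.mem_cons_self)
    rw [totalLost] at hlost
    have := ih r (v :: l) rem' _ (of_charge v (v :: l) _ es b hk (by omega)) (by simpa using hlen)
      ((hr.trans hperm).cons_inv) (by omega)
    simpa using this

theorem look_eq_getD (l : List ℕ) (n : ℕ) : look l n = l.getD n 9 := by
  induction l generalizing n with
  | nil => rfl
  | cons a l ih =>
    cases n with
    | zero => rfl
    | succ n => exact ih n

theorem look_map_range (f : ℕ → ℕ) {n i : ℕ} (hi : i < n) : look ((List.range n).map f) i = f i := by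
  rw [look_eq_getD, List.getD_eq_getElem _ _ (by simpa using hi)]
  simp

theorem look_reverse_map_range (f : ℕ → ℕ) {n i : ℕ} (hi : i ≤ n) :
    look ((List.range (n + 1)).map f).reverse i = f (n - i) := by
  rw [look_eq_getD, List.getD_eq_getElem _ _ (by simp; omega)]
  simp

theorem totalLost_eq_sum (f : ℕ → ℕ) (W : List (List (ℕ × ℕ))) (n : ℕ)
    (hW : ∀ p ∈ W.zipIdx n, ∀ e ∈ p.1, e.1 ≤ p.2) :
    totalLost W ((List.range' n W.length).map f) ((List.range n).map f).reverse =
      (((W.zipIdx n).flatMap fun p => p.1.map fun e => ((p.2 - e.1, p.2), e.2)).map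
        fun e => e.2 * far (f e.1.1) (f e.1.2)).sum := by
  induction W generalizing n with
  | nil => rfl
  | cons es W ih =>
    rw [List.zipIdx_cons, List.forall_mem_cons] at hW
    have hcons : f n :: ((List.range n).map f).reverse =
        ((List.range (n + 1)).map f).reverse := by
      simp [List.range_succ]
    rw [List.length_cons, List.range'_succ, List.map_cons, totalLost, hcons, ih (n + 1) hW.2,
      List.zipIdx_cons, List.flatMap_cons, List.map_append, List.sum_append, List.map_map,
      lostWeight]
    congr 2
    refine List.map_congr_left fun e he => ?_
    simp only [look_reverse_map_range f (hW.1 e he), Function.comp_apply]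

theorem sum_map_flatMap {α β : Type*} (F : β → ℕ) (g : α → List β) (L : List α) :
    ((L.flatMap g).map F).sum = (L.map fun a => ((g a).map F).sum).sum := by
  induction L with
  | nil => rfl
  | cons a L ih => simp [ih]

theorem edges_perm :
    (edges.flatMap fun e => List.replicate e.2 e.1).Perm
      (paths.flatMap fun w =>
        [(min w.1 w.2.1, max w.1 w.2.1), (min w.2.1 w.2.2, max w.2.1 w.2.2)]) := by
  decide +kernel

/-- The weight of the broken edges is at most twice the number of broken paths. -/
theorem totalLost_edgeLevels_le (f : ℕ → ℕ) (hf : ∀ m n, far (f m) (f n) = far (f n) (f m)) :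
    totalLost edgeLevels ((List.range 9).map f) [] ≤
      2 * (paths.map fun w => missed (f w.1) (f w.2.1) (f w.2.2)).sum := by
  have hsum := (edges_perm.map fun e => far (f e.1) (f e.2)).sum_eq
  have hminmax (m n : ℕ) : far (f (min m n)) (f (max m n)) = far (f m) (f n) := by
    obtain h | h := le_total m n
    · simp [h]
    · simp [h, hf m n]
  simp only [sum_map_flatMap, List.map_replicate, List.sum_replicate,
    smul_eq_mul, List.map_cons, List.map_nil, List.sum_cons, List.sum_nil, add_zero,
    hminmax] at hsum
  rw [← List.sum_map_mul_left]
  refine (totalLost_eq_sum f edgeLevels 0 (by decide +kernel)).trans_le (hsum.trans_le ?_)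
  exact List.sum_le_sum fun w _ => far_add_far_le _ _ _

theorem brokenCount_map_range (f : ℕ → ℕ) :
    brokenCount ((List.range 9).map f) =
      (paths.map fun w => missed (f w.1) (f w.2.1) (f w.2.2)).sum := by
  have hpaths : ∀ w ∈ paths, w.1 < 9 ∧ w.2.1 < 9 ∧ w.2.2 < 9 := by decide +kernel
  refine congrArg List.sum (List.map_congr_left fun w hw => ?_)
  obtain ⟨h₁, h₂, h₃⟩ := hpaths w hw
  simp only [look_map_range f h₁, look_map_range f h₂, look_map_range f h₃]

instance : DecidableRel cellAdj := fun a b => by unfold cellAdj; infer_instance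

theorem cellAt_code : ∀ c, cellAt (code c) = c := by decide

theorem code_lt : ∀ c, code c < 9 := by decide

theorem code_injective : Function.Injective code :=
  Function.LeftInverse.injective cellAt_code

theorem far_code : ∀ a b, cellAdj a b → far (code a) (code b) = 0 := by decide +kernel

theorem far_code_comm : ∀ a b, far (code a) (code b) = far (code b) (code a) := by
  decide +kernel

theorem mem_paths : ∀ a b c, cellAdj a b → cellAdj b c → a ≠ c →
    (code a, code b, code c) ∈ paths ∨ (code c, code b, code a) ∈ paths := by
  decide +kernel

theorem sum_add_length_filter {α : Type*} (g : α → ℕ) (hg : ∀ a, g a ≤ 1) (L : List α) :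
    (L.map g).sum + (L.filter fun a => g a = 0).length = L.length := by
  induction L with
  | nil => rfl
  | cons a L ih =>
    have := hg a
    by_cases h : g a = 0 <;> simp [h] <;> omega

/-- A permutation of the cells breaking at most 11 of the 80 undirected paths is a symmetry. -/
theorem mem_squareSymm (π : Fin 3 × Fin 3 → Fin 3 × Fin 3) (hπ : Function.Injective π)
    (h : (paths.map fun w => missed (code (π (cellAt w.1))) (code (π (cellAt w.2.1)))
      (code (π (cellAt w.2.2)))).sum < 12) : π ∈ squareSymm := by
  have hcells : (List.range 9).map cellAt = cellOrder := by decide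
  have hmap : (List.range 9).map (fun n => code (π (cellAt n))) = cellOrder.map (code ∘ π) := by
    rw [← hcells, List.map_map]; rfl
  have hperm : (cellOrder.map (code ∘ π)).Perm [0, 1, 2, 3, 4, 5, 6, 7, 8] := by
    refine (List.subperm_of_subset
      (List.Nodup.map (code_injective.comp hπ) (by decide)) fun x hx => ?_).perm_of_length_le
      (by simp [cellOrder])
    obtain ⟨c, -, rfl⟩ := List.mem_map.mp hx
    have := code_lt (π c)
    simp only [Function.comp_apply, List.mem_cons, List.not_mem_nil, or_false]
    omega
  have hle := totalLost_edgeLevels_le (fun n => code (π (cellAt n))) fun _ _ => far_code_comm _ _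
  have hacc := accept_of_search edgeLevels _ [] _ 23 search_edgeLevels
    (by simp [cellOrder, edgeLevels]) hperm (by rw [← hmap]; omega)
  have hbroken : Nat.ble 12 (brokenCount (cellOrder.map (code ∘ π))) = false := by
    rw [← Bool.not_eq_true, Nat.ble_eq, ← hmap, brokenCount_map_range]
    omega
  rw [List.reverse_nil, List.nil_append, accept, hbroken, Bool.false_or, decide_eq_true_iff] at hacc
  obtain ⟨σ, hσ, heq⟩ := List.mem_map.mp hacc
  rw [List.map_inj_left] at heq
  have hall : ∀ c, c ∈ cellOrder := by decide
  obtain rfl : σ = π := funext fun c => code_injective (heq c (hall c))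
  simpa [symmetries, squareSymm] using hσ

theorem length_paths : paths.length = 80 := rfl

theorem exists_cells_of_mem_wordsOfLen {A : Type*} {B : Fin 3 × Fin 3 → A} {w : List A}
    (hw : w ∈ WordsOfLen B 3) :
    ∃ a b c, w = [B a, B b, B c] ∧ cellAdj a b ∧ cellAdj b c ∧ a ≠ c := by
  obtain ⟨hlen, -, cs, rfl, hnd, hch⟩ := hw
  rw [List.length_map, List.length_eq_three] at hlen
  obtain ⟨a, b, c, rfl⟩ := hlen
  refine ⟨a, b, c, rfl, ?_⟩
  simp_all [List.Chain']

end BoardSearch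

open BoardSearch

/-- For a 3×3 board with nine distinct letters, 137 3-letter words of the board
guarantee a unique solution up to symmetry. -/
theorem words_guarantee_unique (B : Fin 3 × Fin 3 → Fin 9) (hB : Function.Bijective B)
    (P : Finset (List (Fin 9)))
    (hP : ↑P ⊆ WordsOfLen B 3)
    (hcard : 137 ≤ P.card)
    (B' : Fin 3 × Fin 3 → Fin 9) (hB' : Function.Bijective B')
    (hP' : ↑P ⊆ WordsOfLen B' 3) :
    BoardEquiv B B' := by
  obtain ⟨π, hπ⟩ : ∃ π : Fin 3 × Fin 3 → Fin 3 × Fin 3, ∀ c, B (π c) = B' c :=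
    ⟨fun c => (hB.2 (B' c)).choose, fun c => (hB.2 (B' c)).choose_spec⟩
  have hπinj : Function.Injective π := fun a b hab => hB'.1 (by rw [← hπ a, hab, hπ b])
  refine ⟨π, mem_squareSymm π hπinj ?_, funext fun c => (hπ c).symm⟩
  set g : ℕ × ℕ × ℕ → ℕ := fun w => missed (code (π (cellAt w.1))) (code (π (cellAt w.2.1)))
    (code (π (cellAt w.2.2))) with hg
  set K := paths.filter fun w => g w = 0 with hK
  let word (w : ℕ × ℕ × ℕ) : List (Fin 9) :=
    [B' (cellAt w.1), B' (cellAt w.2.1), B' (cellAt w.2.2)]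
  have hsub : P ⊆ (K.map word ++ K.map (List.reverse ∘ word)).toFinset := by
    intro w hw
    obtain ⟨a, b, c, rfl, hab, hbc, hac⟩ := exists_cells_of_mem_wordsOfLen (hP' hw)
    obtain ⟨a', b', c', heq, hab', hbc', -⟩ := exists_cells_of_mem_wordsOfLen (hP hw)
    simp only [List.cons.injEq, ← hπ, hB.1.eq_iff, and_true] at heq
    obtain ⟨rfl, rfl, rfl⟩ := heq
    have hsymm {x y} (h : cellAdj x y) : cellAdj y x := by
      simpa only [cellAdj, ne_comm, abs_sub_comm] using h
    rw [List.mem_toFinset, List.mem_append, List.mem_map, List.mem_map]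
    rcases mem_paths a b c hab hbc hac with h | h
    · refine .inl ⟨(code a, code b, code c), ?_, ?_⟩
      · simp [hK, hg, h, cellAt_code, missed, far_code, hab', hbc']
      · simp [word, cellAt_code]
    · refine .inr ⟨(code c, code b, code a), ?_, ?_⟩
      · simp [hK, hg, h, cellAt_code, missed, far_code, hsymm hab', hsymm hbc']
      · simp [word, cellAt_code]
  have hle := (Finset.card_le_card hsub).trans (List.toFinset_card_le _)
  rw [List.length_append, List.length_map, List.length_map] at hle
  have hsum := sum_add_length_filter g (fun _ => missed_le_one _ _ _) paths
  rw [length_paths, ← hK] at hsum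
  omega
end

section
/- Every 3×3 board with nine distinct letters has exactly 496 four-letter words: for any bijection B : Fin 3 × Fin 3 → Fin 9, the cardinality of W₄(B) is 496. -/
instance inst_s5 : DecidableRel cellAdj := fun a b =>
  inferInstanceAs (Decidable (a ≠ b ∧ |(a.1.val : ℤ) - (b.1.val : ℤ)| ≤ 1 ∧
    |(a.2.val : ℤ) - (b.2.val : ℤ)| ≤ 1))

/-- The injective king paths on four cells, as a finite set of quadruples. -/
def kingPaths : Finset ((Fin 3 × Fin 3) × (Fin 3 × Fin 3) × (Fin 3 × Fin 3) × (Fin 3 × Fin 3)) :=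
  Finset.univ.filter fun (a, b, c, d) =>
    cellAdj a b ∧ cellAdj b c ∧ cellAdj c d ∧ a ≠ c ∧ a ≠ d ∧ b ≠ d

theorem card_kingPaths : kingPaths.card = 496 := by
  decide +kernel

theorem wordsOfLen_four_eq_image {A : Type*} (B : Fin 3 × Fin 3 → A) :
    WordsOfLen B 4 = (fun (a, b, c, d) => [B a, B b, B c, B d]) '' (kingPaths : Set _) := by
  ext w
  constructor
  · rintro ⟨hlen, -, cs, rfl, hnodup, hchain⟩
    rw [List.length_map] at hlen
    obtain ⟨a, b, c, d, rfl⟩ := List.length_eq_four.mp hlen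
    refine ⟨(a, b, c, d), ?_, rfl⟩
    simp only [List.Chain', List.isChain_cons_cons, List.isChain_singleton, and_true] at hchain
    simp at hnodup
    simp [kingPaths]
    tauto
  · rintro ⟨⟨a, b, c, d⟩, h, rfl⟩
    simp only [kingPaths, Finset.coe_filter, Finset.mem_univ, true_and, Set.mem_ofPred_eq] at h
    obtain ⟨hab, hbc, hcd, hac, had, hbd⟩ := h
    refine ⟨rfl, by simp, [a, b, c, d], rfl, ?_, ?_⟩
    · simp [hab.1, hbc.1, hcd.1, hac, had, hbd]
    · simp [List.Chain', hab, hbc, hcd]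

/-- Every 3×3 board with nine distinct letters has exactly 496 4-letter words. -/
theorem card_words (B : Fin 3 × Fin 3 → Fin 9) (hB : Function.Bijective B) :
    (WordsOfLen B 4).ncard = 496 := by
  rw [wordsOfLen_four_eq_image, Set.ncard_image_of_injective, Set.ncard_coe_finset, card_kingPaths]
  rintro ⟨a, b, c, d⟩ ⟨a', b', c', d'⟩ h
  simpa [hB.injective.eq_iff] using h
end

section
/- Any two 3×3 boards of type (8,1) contain exactly the same words: if B, B' : Fin 3 × Fin 3 → Fin 2 are boards in which letter 0 appears on exactly eight cells and letter 1 on exactly one cell, then W(B) = W(B'), regardless of where the single letter 1 is placed. -/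
/-- A closed king's tour of the 3×3 grid. -/
def kingTour : Fin 9 → Fin 3 × Fin 3 :=
  ![(0, 0), (0, 1), (0, 2), (1, 2), (2, 2), (2, 1), (2, 0), (1, 1), (1, 0)]

theorem kingTour_injective : Function.Injective kingTour := by decide

theorem kingTour_surjective : Function.Surjective kingTour := by decide

theorem cellAdj_kingTour_succ (a : Fin 9) : cellAdj (kingTour a) (kingTour (a + 1)) := by
  unfold cellAdj
  revert a
  decide

theorem length_le_nine_of_nodup {cs : List (Fin 3 × Fin 3)} (h : cs.Nodup) : cs.length ≤ 9 := by
  simpa using h.length_le_card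

theorem idxOf_lt_nine_of_nodup {cs : List (Fin 3 × Fin 3)} (h : cs.Nodup)
    (u : Fin 3 × Fin 3) : cs.idxOf u < 9 := by
  by_cases hu : u ∈ cs
  · exact (List.idxOf_lt_length_of_mem hu).trans_le (length_le_nine_of_nodup h)
  · have := length_le_nine_of_nodup (List.nodup_cons.2 ⟨hu, h⟩)
    rw [List.idxOf_of_notMem hu]
    simpa using this

theorem getElem_eq_iff_eq_idxOf {cs : List (Fin 3 × Fin 3)} (h : cs.Nodup)
    (u : Fin 3 × Fin 3) {m : ℕ} (hm : m < cs.length) : cs[m] = u ↔ m = cs.idxOf u := by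
  constructor
  · rintro rfl
    exact (h.idxOf_getElem m hm).symm
  · rintro rfl
    exact List.getElem_idxOf hm

/-- A word of `B` can be laid along the closed tour of `B'` so that its letter `1`, if any, falls
on the cell `u'`; a word without `1` has length at most eight and is laid just before `u'`. -/
theorem words_subset_of_unique_one {B B' : Fin 3 × Fin 3 → Fin 2} {u u' : Fin 3 × Fin 3}
    (hB : ∀ c, B c = 1 ↔ c = u) (hB' : ∀ c, B' c = 1 ↔ c = u') : Words B ⊆ Words B' := by
  rintro w ⟨hlen, cs, rfl, hnd, -⟩
  refine ⟨hlen, ?_⟩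
  obtain ⟨p, rfl⟩ := kingTour_surjective u'
  have hk := length_le_nine_of_nodup hnd
  have hi := idxOf_lt_nine_of_nodup hnd u
  set i : Fin 9 := ⟨cs.idxOf u, hi⟩ with hi_def
  refine ⟨List.ofFn fun m : Fin cs.length => kingTour (m.castLE hk + (p - i)), ?_, ?_, ?_⟩
  · refine List.ext_getElem (by simp) fun m h₁ h₂ => ?_
    have hm : m < cs.length := by simpa using h₂
    have key : B' (kingTour ((⟨m, hm⟩ : Fin cs.length).castLE hk + (p - i))) = 1 ↔
        B cs[m] = 1 := by
      rw [hB, hB', kingTour_injective.eq_iff, getElem_eq_iff_eq_idxOf hnd u hm,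
        add_sub_left_comm, add_eq_left, sub_eq_zero, hi_def, Fin.ext_iff]
      rfl
    simp only [List.getElem_map, List.getElem_ofFn]
    generalize B' _ = x at key ⊢
    generalize B _ = y at key ⊢
    revert x y
    decide
  · rw [List.nodup_ofFn]
    intro a b hab
    exact Fin.castLE_injective hk (add_right_cancel (kingTour_injective hab))
  · refine List.isChain_iff_getElem.2 fun m hm => ?_
    have hm' : m + 1 < cs.length := by simpa using hm
    have hsucc : (⟨m + 1, hm'⟩ : Fin cs.length).castLE hk =
        (⟨m, by lia⟩ : Fin cs.length).castLE hk + 1 := by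
      ext
      simp [Fin.val_add]
      lia
    simp only [List.getElem_ofFn]
    rw [hsucc, add_right_comm]
    exact cellAdj_kingTour_succ _

/-- Any two 3×3 boards of type (8,1) (letter 0 on exactly eight cells and letter 1 on
exactly one cell) contain exactly the same words, regardless of where the single
letter 1 is placed. -/
theorem type81_same_words (B B' : Fin 3 × Fin 3 → Fin 2)
    (hB1 : (Finset.univ.filter fun c => B c = 1).card = 1)
    (hB0 : (Finset.univ.filter fun c => B c = 0).card = 8)
    (hB'1 : (Finset.univ.filter fun c => B' c = 1).card = 1)
    (hB'0 : (Finset.univ.filter fun c => B' c = 0).card = 8) :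
    Words B = Words B' := by
  obtain ⟨u, hu⟩ := Finset.card_eq_one.1 hB1
  obtain ⟨u', hu'⟩ := Finset.card_eq_one.1 hB'1
  have h : ∀ c, B c = 1 ↔ c = u := by simpa [Finset.ext_iff] using hu
  have h' : ∀ c, B' c = 1 ↔ c = u' := by simpa [Finset.ext_iff] using hu'
  exact (words_subset_of_unique_one h h').antisymm (words_subset_of_unique_one h' h)
end

section
/- All 3×3 boards of type (2,1⁷) are solvable: if B, B' : Fin 3 × Fin 3 → Fin 8 are boards in which letter 0 appears on exactly two cells and each of the letters 1 through 7 appears on exactly one cell, and W(B) = W(B'), then B' = B ∘ σ for some σ in the symmetry group of the square acting on Fin 3 × Fin 3. -/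
/-- Row-major number of a cell. -/
def cellCode (c : Fin 3 × Fin 3) : ℕ := 3 * c.1.val + c.2.val

/-- The cell with a given row-major number. -/
def codeCell (n : ℕ) : Fin 3 × Fin 3 := (Fin.ofNat 3 (n / 3), Fin.ofNat 3 (n % 3))

/-- `Nat.testBit` in terms of operations that the kernel evaluates quickly. -/
def bitAt (m n : ℕ) : Bool := Nat.beq (Nat.land (Nat.shiftRight m n) 1) 1

/-- Adjacency of cells in terms of their numbers: bit `9 * a + b` of the numeral is set when the
cells numbered `a` and `b` are adjacent. -/
def codeAdj (a b : ℕ) : Bool := bitAt 834607241378387936705050 (Nat.add (Nat.mul 9 a) b)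

/-- The class of `a` after identifying `p` and `q`. -/
def codeLabel (p q a : ℕ) : ℕ := bif Nat.beq a q then p else a

/-- The eight symmetries of the square. -/
def squareSymmList : List (Fin 3 × Fin 3 → Fin 3 × Fin 3) :=
  [id, rotCell, rotCell ∘ rotCell, rotCell ∘ rotCell ∘ rotCell,
   reflCell, reflCell ∘ rotCell, reflCell ∘ rotCell ∘ rotCell,
   reflCell ∘ rotCell ∘ rotCell ∘ rotCell]

/-- Up to symmetry, the pairs of distinct cells, each with the bitmask (bit `9 * a + b` for the
pair `a`, `b`) of the pairs of distinct cells that become adjacent after identifying the two. -/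
def pairTable : List (ℕ × ℕ × ℕ) :=
  [(0, 1, 834607241413572309056062),
   (0, 2, 834607241413572847761978),
   (0, 4, 839338849282877318527998),
   (0, 5, 839338831514773708635038),
   (0, 8, 881840129614339975576250),
   (1, 3, 834625724432738475964954),
   (1, 4, 844070457116997955877402),
   (1, 7, 844098127233108553693850)]

/-- The mask of pairs of values allowed at two places: adjacent places require a pair in `M`,
other places require a pair of distinct values. -/
def pairMask (M i j : ℕ) : ℕ := bif codeAdj i j then M else 1207744073945406663293950

/-- The mask of values allowed at place `i`, given the values at the places below `j`, listed
with the last place first. -/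
def candidates (M i : ℕ) : List ℕ → ℕ → ℕ
  | [], _ => 511
  | b :: l, j => Nat.land (Nat.shiftRight (pairMask M i (Nat.pred j)) (Nat.mul 9 b))
      (candidates M i l (Nat.pred j))

/-- Backtracking check that each allowed extension of `l`, which fills the places below `i`,
by `k` values below `9` satisfies `leaf`. -/
def searchAll (M : ℕ) (leaf : List ℕ → Bool) : ℕ → ℕ → List ℕ → Bool
  | 0, _, l => leaf l
  | k + 1, i, l => [0, 1, 2, 3, 4, 5, 6, 7, 8].all fun a =>
      bif bitAt (candidates M i l i) a then searchAll M leaf k (Nat.succ i) (a :: l) else true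

/-- The values of `f` below `n`, the last one first. -/
def revValues (f : ℕ → ℕ) : ℕ → List ℕ
  | 0 => []
  | n + 1 => f n :: revValues f n

/-- `g` agrees with a symmetry of the square after identifying `p` and `q`. -/
def leafSymm (p q : ℕ) (g : ℕ → ℕ) : Bool :=
  squareSymmList.any fun σ => (List.range 9).all fun n =>
    codeLabel p q (g n) == codeLabel p q (cellCode (σ (codeCell n)))

/-- Some pair of adjacent cells is not matched by the images under `g` of adjacent cells. -/
def leafMissing (p q : ℕ) (g : ℕ → ℕ) : Bool :=
  (List.range 9).any fun a => (List.range 9).any fun b => codeAdj a b &&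
    (List.range 9).all fun c => !(codeLabel p q (g c) == codeLabel p q a) ||
      (List.range 9).all fun d => !(codeLabel p q (g d) == codeLabel p q b && codeAdj c d)

/-- The images under `g` of some three-cell path are not matched by any three-cell path. -/
def leafExtra (p q : ℕ) (g : ℕ → ℕ) : Bool :=
  (List.range 9).any fun a => (List.range 9).any fun b => codeAdj a b &&
    (List.range 9).any fun c => (codeAdj b c && !(a == c)) &&
      (List.range 9).all fun x => !(codeLabel p q x == codeLabel p q (g a)) ||
        (List.range 9).all fun y => !(codeLabel p q y == codeLabel p q (g b) && codeAdj x y) ||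
          (List.range 9).all fun z =>
            !(codeLabel p q z == codeLabel p q (g c) && (codeAdj y z && !(x == z)))

/-- The test applied to the function with values `l`, listed with the last value first. -/
def leafTest (p q : ℕ) (l : List ℕ) : Bool :=
  leafSymm p q (fun n => l.getD (8 - n) 0) || (leafMissing p q (fun n => l.getD (8 - n) 0) ||
    leafExtra p q (fun n => l.getD (8 - n) 0))

/-- Pairs of distinct cells in the classes of two adjacent cells belong to `M`. -/
def maskTest (p q M : ℕ) : Bool :=
  (List.range 9).all fun a => (List.range 9).all fun b => !codeAdj a b ||
    (List.range 9).all fun c => !(codeLabel p q c == codeLabel p q a) ||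
      (List.range 9).all fun d => !(codeLabel p q d == codeLabel p q b) || (c == d ||
        bitAt M (9 * c + d))

theorem maskTest_pairTable : ∀ t ∈ pairTable, maskTest t.1 t.2.1 t.2.2 = true := by
  decide +kernel

theorem searchAll_pairTable : ∀ t ∈ pairTable,
    searchAll t.2.2 (leafTest t.1 t.2.1) 9 0 [] = true := by
  decide +kernel

instance (a b : Fin 3 × Fin 3) : Decidable (cellAdj a b) :=
  inferInstanceAs (Decidable (_ ∧ _))

theorem codeAdj_cellCode : ∀ a b : Fin 3 × Fin 3,
    codeAdj (cellCode a) (cellCode b) = true ↔ cellAdj a b := by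
  decide +kernel

theorem codeCell_cellCode : ∀ c : Fin 3 × Fin 3, codeCell (cellCode c) = c := by
  decide +kernel

theorem cellCode_injective : Function.Injective cellCode :=
  Function.LeftInverse.injective codeCell_cellCode

theorem cellCode_codeCell : ∀ n < 9, cellCode (codeCell n) = n := by
  decide +kernel

theorem cellCode_lt : ∀ c : Fin 3 × Fin 3, cellCode c < 9 := by
  decide +kernel

theorem bitAt_eq_testBit (m n : ℕ) : bitAt m n = m.testBit n := by
  have h : bitAt m n = (((m >>> n) &&& 1) == 1) := by
    rw [Bool.eq_iff_iff]
    simp only [bitAt, beq_iff_eq]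
    exact iff_of_eq Nat.beq_eq
  rw [h, Nat.testBit, Nat.and_comm, Nat.one_and_eq_mod_two]
  rcases Nat.mod_two_eq_zero_or_one (m >>> n) with h | h <;> rw [h] <;> rfl

theorem bitAt_ne : ∀ a < 9, ∀ b < 9, a ≠ b →
    bitAt 1207744073945406663293950 (9 * a + b) = true := by
  decide +kernel

theorem bitAt_candidates {M i a : ℕ} (f : ℕ → ℕ) (ha : a < 9) {n : ℕ}
    (h : ∀ j < n, bitAt (pairMask M i j) (9 * f j + a) = true) :
    bitAt (candidates M i (revValues f n) n) a = true := by
  induction n with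
  | zero =>
    have : ∀ a < 9, bitAt 511 a = true := by decide +kernel
    exact this a ha
  | succ n ih =>
    have h1 := ih fun j hj => h j (by omega)
    have h2 := h n (by omega)
    rw [bitAt_eq_testBit] at h1 h2 ⊢
    change ((pairMask M i n >>> (9 * f n)) &&& candidates M i (revValues f n) n).testBit a = true
    rw [Nat.testBit_and, Nat.testBit_shiftRight, h1, h2]
    rfl

theorem leaf_of_searchAll {M : ℕ} {leaf : List ℕ → Bool} (f : ℕ → ℕ) {n : ℕ}
    (hf : ∀ i < n, f i < 9)
    (hM : ∀ i < n, ∀ j < i, bitAt (pairMask M i j) (9 * f j + f i) = true) (k i : ℕ)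
    (hk : i + k = n) (h : searchAll M leaf k i (revValues f i) = true) :
    leaf (revValues f n) = true := by
  induction k generalizing i with
  | zero =>
    obtain rfl : i = n := by omega
    exact h
  | succ k ih =>
    refine ih (i + 1) (by omega) ?_
    have hi := hf i (by omega)
    have h1 := bitAt_candidates (M := M) (i := i) f hi (hM i (by omega))
    rw [searchAll, List.all_eq_true] at h
    have h2 := h (f i) (by simp only [List.mem_cons, List.not_mem_nil, or_false]; omega)
    rw [h1] at h2
    exact h2

theorem mem_squareSymm_iff (σ : Fin 3 × Fin 3 → Fin 3 × Fin 3) :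
    σ ∈ squareSymm ↔ σ ∈ squareSymmList := by
  simp [squareSymm, squareSymmList]

theorem squareSymm_comp {σ τ : Fin 3 × Fin 3 → Fin 3 × Fin 3} (hσ : σ ∈ squareSymm)
    (hτ : τ ∈ squareSymm) : σ ∘ τ ∈ squareSymm := by
  rw [mem_squareSymm_iff] at *
  have : (squareSymmList.all fun σ => squareSymmList.all fun τ => squareSymmList.any fun ρ =>
      (List.range 9).all fun n =>
        cellCode (ρ (codeCell n)) == cellCode (σ (τ (codeCell n)))) = true := by
    decide +kernel
  simp only [List.all_eq_true, List.any_eq_true, List.mem_range, beq_iff_eq] at this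
  obtain ⟨ρ, hρ, h⟩ := this σ hσ τ hτ
  convert hρ using 1
  funext c
  have := h _ (cellCode_lt c)
  rw [codeCell_cellCode] at this
  exact cellCode_injective this.symm

theorem squareSymm_exists_inverse {σ : Fin 3 × Fin 3 → Fin 3 × Fin 3} (hσ : σ ∈ squareSymm) :
    ∃ τ ∈ squareSymm, σ ∘ τ = id ∧ τ ∘ σ = id := by
  simp only [mem_squareSymm_iff] at *
  have : (squareSymmList.all fun σ => squareSymmList.any fun τ => (List.range 9).all fun n =>
      cellCode (σ (τ (codeCell n))) == n && cellCode (τ (σ (codeCell n))) == n) = true := by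
    decide +kernel
  simp only [List.all_eq_true, List.any_eq_true, List.mem_range, Bool.and_eq_true,
    beq_iff_eq] at this
  obtain ⟨τ, hτ, h⟩ := this σ hσ
  have h' (c) := h _ (cellCode_lt c)
  simp only [codeCell_cellCode] at h'
  exact ⟨τ, hτ, funext fun c => cellCode_injective (h' c).1,
    funext fun c => cellCode_injective (h' c).2⟩

theorem squareSymm_cellAdj {σ : Fin 3 × Fin 3 → Fin 3 × Fin 3} (hσ : σ ∈ squareSymm)
    {a b : Fin 3 × Fin 3} (h : cellAdj a b) : cellAdj (σ a) (σ b) := by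
  rw [mem_squareSymm_iff] at hσ
  have : (squareSymmList.all fun σ => (List.range 9).all fun m => (List.range 9).all fun n =>
      !codeAdj m n || codeAdj (cellCode (σ (codeCell m))) (cellCode (σ (codeCell n)))) = true := by
    decide +kernel
  simp only [List.all_eq_true, List.mem_range, Bool.or_eq_true, Bool.not_eq_true'] at this
  have h1 := this σ hσ _ (cellCode_lt a) _ (cellCode_lt b)
  rw [codeCell_cellCode, codeCell_cellCode] at h1
  rw [← codeAdj_cellCode] at h ⊢
  exact h1.resolve_left (by simp [h])

theorem words_comp_subset {A : Type*} (B : Fin 3 × Fin 3 → A) {σ : Fin 3 × Fin 3 → Fin 3 × Fin 3}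
    (hσ : σ ∈ squareSymm) : Words (B ∘ σ) ⊆ Words B := by
  rintro w ⟨hw, cs, rfl, hn, hc⟩
  obtain ⟨τ, -, -, hτ⟩ := squareSymm_exists_inverse hσ
  refine ⟨hw, cs.map σ, by simp, hn.map (Function.LeftInverse.injective (congrFun hτ)), ?_⟩
  exact List.isChain_map_of_isChain σ (fun _ _ => squareSymm_cellAdj hσ) hc

theorem words_comp {A : Type*} (B : Fin 3 × Fin 3 → A) {σ : Fin 3 × Fin 3 → Fin 3 × Fin 3}
    (hσ : σ ∈ squareSymm) : Words (B ∘ σ) = Words B := by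
  refine (words_comp_subset B hσ).antisymm ?_
  obtain ⟨τ, hτ, h, -⟩ := squareSymm_exists_inverse hσ
  have := words_comp_subset (B ∘ σ) hτ
  rwa [Function.comp_assoc, h, Function.comp_id] at this

theorem pair_mem_words_iff {A : Type*} (B : Fin 3 × Fin 3 → A) (x y : A) :
    [x, y] ∈ Words B ↔ ∃ a b, cellAdj a b ∧ B a = x ∧ B b = y := by
  constructor
  · rintro ⟨-, cs, hm, -, hc⟩
    match cs, hm with
    | [a, b], hm => exact ⟨a, b, List.isChain_pair.1 hc, by simpa using hm⟩
  · rintro ⟨a, b, h, rfl, rfl⟩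
    exact ⟨by simp, [a, b], by simp, by simpa using h.1, List.isChain_pair.2 h⟩

theorem triple_mem_words_iff {A : Type*} (B : Fin 3 × Fin 3 → A) (x y z : A) :
    [x, y, z] ∈ Words B ↔
      ∃ a b c, cellAdj a b ∧ cellAdj b c ∧ a ≠ c ∧ B a = x ∧ B b = y ∧ B c = z := by
  constructor
  · rintro ⟨-, cs, hm, hn, hc⟩
    match cs, hm with
    | [a, b, c], hm =>
      have hc' := List.isChain_cons_cons.1 hc
      simp only [List.nodup_cons, List.mem_cons, not_or] at hn
      exact ⟨a, b, c, hc'.1, List.isChain_pair.1 hc'.2, hn.1.2.1, by simpa using hm⟩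
  · rintro ⟨a, b, c, h, h', hac, rfl, rfl, rfl⟩
    exact ⟨by simp, [a, b, c], by simp, by simp [h.1, h'.1, hac],
      List.isChain_cons_cons.2 ⟨h, List.isChain_pair.2 h'⟩⟩

theorem exists_squareSymm_of_mem_pairTable {A : Type*} {B B' : Fin 3 × Fin 3 → A}
    {π : Fin 3 × Fin 3 → Fin 3 × Fin 3} (hπ : Function.Injective π) (hB' : B' = B ∘ π)
    {t : ℕ × ℕ × ℕ} (ht : t ∈ pairTable)
    (hB : ∀ a b, B a = B b ↔
      codeLabel t.1 t.2.1 (cellCode a) = codeLabel t.1 t.2.1 (cellCode b))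
    (hW : Words B = Words B') : ∃ σ ∈ squareSymm, B' = B ∘ σ := by
  obtain ⟨p, q, M⟩ := t
  have hM := maskTest_pairTable _ ht
  have hS := searchAll_pairTable _ ht
  dsimp only at hB hM hS
  have H2 : ∀ a b, cellAdj a b → ∃ x y, cellAdj x y ∧ B x = B (π a) ∧ B y = B (π b) := by
    intro a b h
    rw [← pair_mem_words_iff, hW, pair_mem_words_iff, hB']
    exact ⟨a, b, h, rfl, rfl⟩
  have H2' : ∀ a b, cellAdj a b → ∃ x y, cellAdj x y ∧ B (π x) = B a ∧ B (π y) = B b := by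
    intro a b h
    have := (pair_mem_words_iff B (B a) (B b)).2 ⟨a, b, h, rfl, rfl⟩
    rw [hW, pair_mem_words_iff, hB'] at this
    exact this
  have H3 : ∀ a b c, cellAdj a b → cellAdj b c → a ≠ c → ∃ x y z, cellAdj x y ∧ cellAdj y z ∧
      x ≠ z ∧ B x = B (π a) ∧ B y = B (π b) ∧ B z = B (π c) := by
    intro a b c h h' hac
    rw [← triple_mem_words_iff, hW, triple_mem_words_iff, hB']
    exact ⟨a, b, c, h, h', hac, rfl, rfl, rfl⟩
  set f : ℕ → ℕ := fun n => cellCode (π (codeCell n)) with hf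
  have hadj : ∀ {a b : ℕ}, a < 9 → b < 9 → codeAdj a b = true →
      cellAdj (codeCell a) (codeCell b) := by
    intro a b ha hb h
    rwa [← codeAdj_cellCode, cellCode_codeCell a ha, cellCode_codeCell b hb]
  have hleaf : leafTest p q (revValues f 9) = true := by
    refine leaf_of_searchAll f (fun i _ => cellCode_lt _) (fun i hi j hj => ?_) 9 0 rfl hS
    have hne : π (codeCell j) ≠ π (codeCell i) := by
      intro h
      have := congrArg cellCode (hπ h)
      rw [cellCode_codeCell i hi, cellCode_codeCell j (by omega)] at this
      omega
    have hne' : f j ≠ f i := fun h => hne (cellCode_injective h)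
    cases hij : codeAdj i j with
    | false =>
      rw [pairMask, hij]
      exact bitAt_ne _ (cellCode_lt _) _ (cellCode_lt _) hne'
    | true =>
      rw [pairMask, hij]
      obtain ⟨x, y, hxy, hx, hy⟩ := H2 _ _ (hadj hi (by omega) hij)
      have hyx : cellAdj y x := ⟨hxy.1.symm, by rw [abs_sub_comm]; exact hxy.2.1,
        by rw [abs_sub_comm]; exact hxy.2.2⟩
      rw [← codeAdj_cellCode] at hyx
      rw [hB] at hx hy
      simp only [maskTest, List.all_eq_true, List.mem_range, Bool.or_eq_true, Bool.not_eq_true',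
        beq_iff_eq, beq_eq_false_iff_ne] at hM
      have h1 := (hM _ (cellCode_lt y) _ (cellCode_lt x)).resolve_left (by simp [hyx])
      have h2 := (h1 _ (cellCode_lt (π (codeCell j)))).resolve_left (by simp [hy])
      have h3 := (h2 _ (cellCode_lt (π (codeCell i)))).resolve_left (by simp [hx])
      exact h3.resolve_left hne'
  have hget : ∀ n < 9, (revValues f 9).getD (8 - n) 0 = f n := by
    intro n hn
    interval_cases n <;> rfl
  rw [leafTest, Bool.or_eq_true, Bool.or_eq_true] at hleaf
  have hfB : ∀ {c : Fin 3 × Fin 3} {n : ℕ}, codeLabel p q (f n) = codeLabel p q (cellCode c) ↔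
      B (π (codeCell n)) = B c := by
    intro c n
    rw [hB]
  rcases hleaf with h | h | h
  · simp only [leafSymm, List.any_eq_true, List.all_eq_true, List.mem_range, beq_iff_eq] at h
    obtain ⟨σ, hσ, h⟩ := h
    refine ⟨σ, (mem_squareSymm_iff σ).2 hσ, ?_⟩
    funext c
    have := h _ (cellCode_lt c)
    rw [hget _ (cellCode_lt c), hfB, codeCell_cellCode] at this
    rw [hB']
    exact this
  · exfalso
    simp only [leafMissing, List.any_eq_true, List.all_eq_true, List.mem_range,
      Bool.and_eq_true, Bool.or_eq_true, Bool.not_eq_true', beq_eq_false_iff_ne,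
      Bool.and_eq_false_iff] at h
    obtain ⟨a, ha, b, hb, hab, h⟩ := h
    obtain ⟨x, y, hxy, hx, hy⟩ := H2' _ _ (hadj ha hb hab)
    rw [hB, cellCode_codeCell _ ha] at hx
    rw [hB, cellCode_codeCell _ hb] at hy
    rw [← codeAdj_cellCode] at hxy
    have h1 := h _ (cellCode_lt x)
    rw [hget _ (cellCode_lt x)] at h1
    simp only [hf, codeCell_cellCode, hx, ne_eq, not_true_eq_false, false_or] at h1
    have h2 := h1 _ (cellCode_lt y)
    rw [hget _ (cellCode_lt y)] at h2
    simp [hf, codeCell_cellCode, hy, hxy] at h2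
  · exfalso
    simp only [leafExtra, List.any_eq_true, List.all_eq_true, List.mem_range,
      Bool.and_eq_true, Bool.or_eq_true, Bool.not_eq_true', beq_eq_false_iff_ne,
      Bool.and_eq_false_iff] at h
    obtain ⟨a, ha, b, hb, hab, c, hc, ⟨hbc, hac⟩, h⟩ := h
    obtain ⟨x, y, z, hxy, hyz, hxz, hx, hy, hz⟩ := H3 _ _ _ (hadj ha hb hab) (hadj hb hc hbc)
      (fun h => hac (by rw [← cellCode_codeCell a ha, h, cellCode_codeCell c hc]))
    rw [hget a ha, hget b hb, hget c hc] at h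
    rw [hB] at hx hy hz
    rw [← codeAdj_cellCode] at hxy hyz
    have h1 := (h _ (cellCode_lt x)).resolve_left (not_not.2 hx)
    have h2 := (h1 _ (cellCode_lt y)).resolve_left (by simp [hf, hy, hxy])
    have hxz' : cellCode x ≠ cellCode z := fun h => hxz (cellCode_injective h)
    rcases h2 _ (cellCode_lt z) with h3 | h3 | h3
    · exact h3 hz
    · simp [hyz] at h3
    · simp [hxz'] at h3

theorem exists_mem_pairTable : ∀ p q : Fin 3 × Fin 3, p ≠ q → ∃ t ∈ pairTable,
    ∃ τ ∈ squareSymmList,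
      (τ (codeCell t.1) = p ∧ τ (codeCell t.2.1) = q) ∨
      (τ (codeCell t.1) = q ∧ τ (codeCell t.2.1) = p) := by
  decide +kernel

theorem codeLabel_eq_iff : ∀ t ∈ pairTable, ∀ a b : Fin 3 × Fin 3,
    codeLabel t.1 t.2.1 (cellCode a) = codeLabel t.1 t.2.1 (cellCode b) ↔
      a = b ∨ (a = codeCell t.1 ∨ a = codeCell t.2.1) ∧ (b = codeCell t.1 ∨ b = codeCell t.2.1) := by
  decide +kernel

theorem exists_equiv_of_card_fiber_eq {α β : Type*} [Fintype α] [DecidableEq β] (f g : α → β)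
    (h : ∀ i, (Finset.univ.filter fun c => f c = i).card =
      (Finset.univ.filter fun c => g c = i).card) : ∃ e : α ≃ α, g = f ∘ e := by
  have (i : β) : Nonempty ({c // g c = i} ≃ {c // f c = i}) := by
    rw [← Fintype.card_eq, Fintype.card_subtype, Fintype.card_subtype, h i]
  exact ⟨Equiv.ofFiberEquiv fun i => (this i).some,
    funext fun a => (Equiv.ofFiberEquiv_map (fun i => (this i).some) a).symm⟩

/-- All 3×3 boards of type (2,1⁷) are solvable: if two such boards (letter 0 on
exactly two cells, each other letter on exactly one cell) have the same set of words,
then they differ by a symmetry of the square. -/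
theorem type217_solvable (B B' : Fin 3 × Fin 3 → Fin 8)
    (hB0 : (Finset.univ.filter fun c => B c = 0).card = 2)
    (hB1 : ∀ i : Fin 8, i ≠ 0 → (Finset.univ.filter fun c => B c = i).card = 1)
    (hB'0 : (Finset.univ.filter fun c => B' c = 0).card = 2)
    (hB'1 : ∀ i : Fin 8, i ≠ 0 → (Finset.univ.filter fun c => B' c = i).card = 1)
    (hW : Words B = Words B') :
    ∃ σ ∈ squareSymm, B' = B ∘ σ := by
  obtain ⟨e, he⟩ := exists_equiv_of_card_fiber_eq B B' fun i => by
    by_cases hi : i = 0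
    · rw [hi, hB0, hB'0]
    · rw [hB1 i hi, hB'1 i hi]
  obtain ⟨p, q, hpq, hs⟩ := Finset.card_eq_two.1 hB0
  have hzero : ∀ c, B c = 0 ↔ c = p ∨ c = q := fun c => by
    simpa using congrArg (c ∈ ·) hs
  obtain ⟨t, ht, τ, hτ, htτ⟩ := exists_mem_pairTable p q hpq
  rw [← mem_squareSymm_iff] at hτ
  obtain ⟨ρ, hρ, hτρ, hρτ⟩ := squareSymm_exists_inverse hτ
  have hτ_inj : Function.Injective τ := Function.LeftInverse.injective (congrFun hρτ)
  have hρ_inj : Function.Injective ρ := Function.LeftInverse.injective (congrFun hτρ)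
  have hBτ : ∀ c, B (τ c) = 0 ↔ c = codeCell t.1 ∨ c = codeCell t.2.1 := by
    intro c
    rw [hzero]
    rcases htτ with ⟨rfl, rfl⟩ | ⟨rfl, rfl⟩
    · simp only [hτ_inj.eq_iff]
    · simp only [hτ_inj.eq_iff, or_comm]
  obtain ⟨σ, hσ, h⟩ := exists_squareSymm_of_mem_pairTable (B := B ∘ τ) (B' := B') (π := ρ ∘ e)
    (hρ_inj.comp e.injective)
    (by rw [Function.comp_assoc, ← Function.comp_assoc τ, hτρ, Function.id_comp, he]) ht
    (fun a b => by
      rw [codeLabel_eq_iff t ht, ← hBτ, ← hBτ, Function.comp_apply, Function.comp_apply]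
      constructor
      · intro hab
        by_cases h0 : B (τ b) = 0
        · exact Or.inr ⟨hab.trans h0, h0⟩
        · obtain ⟨c, hc⟩ := Finset.card_eq_one.1 (hB1 _ h0)
          have h1 : τ a = c := by simpa [hab] using congrArg (τ a ∈ ·) hc
          have h2 : τ b = c := by simpa using congrArg (τ b ∈ ·) hc
          exact Or.inl (hτ_inj (h1.trans h2.symm))
      · rintro (rfl | ⟨ha, hb⟩)
        · rfl
        · rw [ha, hb])
    ((words_comp B hτ).trans hW)
  exact ⟨τ ∘ σ, squareSymm_comp hτ hσ, h⟩
end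

section
/- For 3×3 boards of type (2,1⁷), a board whose two cells carrying the repeated letter are adjacent is never equivalent to one whose two such cells are non-adjacent: if B, B' : Fin 3 × Fin 3 → Fin 8 are boards in which letter 0 appears on exactly two cells and letters 1 through 7 each appear on exactly one cell, the two cells of B carrying letter 0 are adjacent, and the two cells of B' carrying letter 0 are not adjacent, then W(B) ≠ W(B'). -/
/-- For 3×3 boards of type (2,1⁷): a board whose two cells carrying the repeated
letter are adjacent never has the same word set as a board whose two such cells are
non-adjacent. -/
theorem type217_adj_vs_nonadj (B B' : Fin 3 × Fin 3 → Fin 8)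
    (hB0 : (Finset.univ.filter fun c => B c = 0).card = 2)
    (hB1 : ∀ i : Fin 8, i ≠ 0 → (Finset.univ.filter fun c => B c = i).card = 1)
    (hB'0 : (Finset.univ.filter fun c => B' c = 0).card = 2)
    (hB'1 : ∀ i : Fin 8, i ≠ 0 → (Finset.univ.filter fun c => B' c = i).card = 1)
    (hadj : ∀ c c' : Fin 3 × Fin 3, B c = 0 → B c' = 0 → c ≠ c' → cellAdj c c')
    (hnadj : ∀ c c' : Fin 3 × Fin 3, B' c = 0 → B' c' = 0 → c ≠ c' → ¬ cellAdj c c') :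
    Words B ≠ Words B' := by
  intro hW
  obtain ⟨a, b, hab, hs⟩ := Finset.card_eq_two.mp hB0
  have h_zero : ∀ c, B c = 0 ↔ c = a ∨ c = b := by simpa [Finset.ext_iff] using hs
  have ha : B a = 0 := (h_zero a).mpr (Or.inl rfl)
  have hb : B b = 0 := (h_zero b).mpr (Or.inr rfl)
  have h_mem : [0, 0] ∈ Words B :=
    ⟨le_rfl, [a, b], by simp [ha, hb], by simpa using hab, List.isChain_pair.mpr (hadj a b ha hb hab)⟩
  rw [hW] at h_mem
  obtain ⟨-, cs, hmap, -, hchain⟩ := h_mem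
  obtain ⟨c, l, rfl, hc, hl⟩ := List.map_eq_cons_iff.mp hmap
  obtain ⟨d, l', rfl, hd, hl'⟩ := List.map_eq_cons_iff.mp hl
  have hcd : cellAdj c d := (List.isChain_cons_cons.mp hchain).1
  exact hnadj c d hc hd hcd.1 hcd
end
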